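/- Let (s_j)_{j=0}^{m} be an α-Stieltjes right-nonnegative definite sequence with right α-Stieltjes parametrization (Q_j)_{j=0}^{m}. Then Q_m = s_0^{[m,α]} + Σ_{k=0}^{m-1} P_{m-k,k} (with empty sum for m = 0), and for m ≥ 1 one has Q_j = s_0^{[j,α]} for all 0 ≤ j ≤ m−1, where P_{j,k} := s_j^{[k,α]} − s_0^{[k,α]}(s_0^{[k,α]})^{+} s_j^{[k,α]} (s_0^{[k,α]})^{+} s_0^{[k,α]}. -/

import Mathlib

open Matrix BigOperators ComplexOrder

def IsMP {m n : Type*} [Fintype m] [Fintype n] (A : Matrix m n ℂ) (B : Matrix n m ℂ) : Prop :=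
  A * B * A = A ∧ B * A * B = B ∧ (A * B)ᴴ = A * B ∧ (B * A)ᴴ = B * A

open Classical in
noncomputable def mp {m n : Type*} [Fintype m] [Fintype n] (A : Matrix m n ℂ) : Matrix n m ℂ :=
  if h : ∃ B, IsMP A B then h.choose else 0

noncomputable def recip {p q : ℕ} (s : ℕ → Matrix (Fin p) (Fin q) ℂ) :
    ℕ → Matrix (Fin q) (Fin p) ℂ
  | 0 => mp (s 0)
  | (j+1) => -(mp (s 0) * ∑ l : Fin (j+1), s (j+1 - l.val) * recip s l.val)
termination_by j => j
decreasing_by exact l.isLt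

noncomputable def shiftA {p q : ℕ} (α : ℂ) (s : ℕ → Matrix (Fin p) (Fin q) ℂ) :
    ℕ → Matrix (Fin p) (Fin q) ℂ
  | 0 => s 0
  | (j+1) => (-α) • s j + s (j+1)

noncomputable def recipA {p q : ℕ} (α : ℂ) (s : ℕ → Matrix (Fin p) (Fin q) ℂ) :
    ℕ → Matrix (Fin q) (Fin p) ℂ :=
  recip (shiftA α s)

/-- the first α-Schur transform. -/
noncomputable def schur1 {p q : ℕ} (α : ℂ) (s : ℕ → Matrix (Fin p) (Fin q) ℂ) :
    ℕ → Matrix (Fin p) (Fin q) ℂ :=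
  fun j => s 0 * (-(recipA α s (j + 1))) * s 0

/-- block Hankel matrix H_n = [s_{j+k}]_{j,k=0}^{n}. -/
def hankelMat {p q : ℕ} (s : ℕ → Matrix (Fin p) (Fin q) ℂ) (n : ℕ) :
    Matrix (Fin (n + 1) × Fin p) (Fin (n + 1) × Fin q) ℂ :=
  Matrix.of fun jk lm => s (jk.1.val + lm.1.val) jk.2 lm.2

/-- block Hankel matrix K_n = [s_{j+k+1}]_{j,k=0}^{n}. -/
def hankelKMat {p q : ℕ} (s : ℕ → Matrix (Fin p) (Fin q) ℂ) (n : ℕ) :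
    Matrix (Fin (n + 1) × Fin p) (Fin (n + 1) × Fin q) ℂ :=
  Matrix.of fun jk lm => s (jk.1.val + lm.1.val + 1) jk.2 lm.2

/-- the class K^{≥}_{q,κ,α} of α-Stieltjes right-nonnegative definite sequences. -/
def Kgg {q : ℕ} (α : ℝ) (κ : ℕ∞) (s : ℕ → Matrix (Fin q) (Fin q) ℂ) : Prop :=
  (∀ n : ℕ, ((2 * n : ℕ) : ℕ∞) ≤ κ → (hankelMat s n).PosSemidef) ∧
  (∀ n : ℕ, ((2 * n + 1 : ℕ) : ℕ∞) ≤ κ →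
    ((-(α : ℂ)) • hankelMat s n + hankelKMat s n).PosSemidef)

/-- L_k, the Schur complement s_{2k} − z_{k,2k-1} H_{k-1}^+ y_{k,2k-1}. -/
noncomputable def Lschur {q : ℕ} (s : ℕ → Matrix (Fin q) (Fin q) ℂ) (k : ℕ) :
    Matrix (Fin q) (Fin q) ℂ :=
  s (2 * k) -
    (Matrix.of fun (a : Fin q) (lm : Fin k × Fin q) => s (k + lm.1.val) a lm.2) *
      mp (Matrix.of fun (jm : Fin k × Fin q) (lm : Fin k × Fin q) =>
        s (jm.1.val + lm.1.val) jm.2 lm.2) *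
      (Matrix.of fun (jm : Fin k × Fin q) (b : Fin q) => s (k + jm.1.val) jm.2 b)

/-- the right α-Stieltjes parametrization: Q_{2k} = L_k, Q_{2k+1} = L_{α,k}. -/
noncomputable def stieltjesParam {q : ℕ} (α : ℂ) (s : ℕ → Matrix (Fin q) (Fin q) ℂ) :
    ℕ → Matrix (Fin q) (Fin q) ℂ :=
  fun j =>
    if Even j then Lschur s (j / 2)
    else Lschur (fun i => (-α) • s i + s (i + 1)) (j / 2)

/-- P_{j,k} = s_j^{[k,α]} − s_0^{[k,α]}(s_0^{[k,α]})^+ s_j^{[k,α]}(s_0^{[k,α]})^+ s_0^{[k,α]}. -/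
noncomputable def Pjk {q : ℕ} (α : ℂ) (s : ℕ → Matrix (Fin q) (Fin q) ℂ) (j k : ℕ) :
    Matrix (Fin q) (Fin q) ℂ :=
  (schur1 α)^[k] s j -
    (schur1 α)^[k] s 0 * mp ((schur1 α)^[k] s 0) * (schur1 α)^[k] s j *
      mp ((schur1 α)^[k] s 0) * (schur1 α)^[k] s 0

section MoorePenrose

theorem exists_isMP_of_isHermitian {n : Type*} [Fintype n] {A : Matrix n n ℂ}
    (hA : A.IsHermitian) : ∃ B, IsMP A B := by
  classical
  set φ := Unitary.conjStarAlgAut ℂ (Matrix n n ℂ) hA.eigenvectorUnitary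
  set d : n → ℂ := RCLike.ofReal ∘ hA.eigenvalues
  have hspec : A = φ (diagonal d) := hA.spectral_theorem
  have hstar : ∀ M, (φ M)ᴴ = φ Mᴴ := fun M => (map_star φ M).symm
  refine ⟨φ (diagonal fun i => (d i)⁻¹), ?_, ?_, ?_, ?_⟩
  all_goals
    rw [hspec]
    simp only [← map_mul, diagonal_mul_diagonal, hstar, diagonal_conjTranspose]
    congr 2
    funext i
    by_cases h : d i = 0
    · simp [h]
    · simp [h]

theorem isMP_mp_of_isHermitian {n : Type*} [Fintype n] {A : Matrix n n ℂ}
    (hA : A.IsHermitian) : IsMP A (mp A) := by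
  have h := exists_isMP_of_isHermitian hA
  rw [mp, dif_pos h]
  exact h.choose_spec

theorem IsMP.comm_of_isHermitian {n : Type*} [Fintype n] {A B : Matrix n n ℂ}
    (hA : A.IsHermitian) (h : IsMP A B) : B * A = A * B := by
  obtain ⟨h1, -, h3, h4⟩ := h
  have hA1 : A * (A * B) = A := by
    have := congrArg conjTranspose h1
    rwa [conjTranspose_mul, h3, hA.eq] at this
  have hA2 : B * A * A = A := by
    have := congrArg conjTranspose (show A * (B * A) = A by rw [← mul_assoc, h1])
    rwa [conjTranspose_mul, h4, hA.eq] at this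
  have h5 : B * A * (A * B) = A * B := by rw [← mul_assoc, hA2]
  have h6 : B * A * (A * B) = B * A := by rw [mul_assoc, hA1]
  rw [← h6, h5]

end MoorePenrose

theorem Matrix.PosSemidef.mul_eq_zero_of_conjTranspose_mul_mul_eq_zero {m n : Type*} [Fintype m]
    {M : Matrix m m ℂ} (hM : M.PosSemidef) (X : Matrix m n ℂ) (h : Xᴴ * M * X = 0) :
    M * X = 0 := by
  ext i j
  have h0 : star (fun k => X k j) ⬝ᵥ M *ᵥ (fun k => X k j) = 0 := by
    have := congrFun (congrFun h j) j
    rw [Matrix.mul_assoc] at this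
    exact this
  exact congrFun ((hM.dotProduct_mulVec_zero_iff _).1 h0) i

section PowerSeries

open PowerSeries Finset

variable {R : Type*} [Ring R]

theorem sum_mul_shift_of_mul_eq_C {f g : PowerSeries R} {P : R} (h : f * g = C P) (n : ℕ) :
    ∑ i ∈ range (n + 1), coeff (i + 1) f * coeff (n - i) g = -(coeff 0 f * coeff (n + 1) g) := by
  have h1 := congrArg (coeff (n + 1)) h
  rw [coeff_mul, Nat.sum_antidiagonal_eq_sum_range_succ (fun i j => coeff i f * coeff j g),
    Finset.sum_range_succ'] at h1
  simp only [coeff_C, Nat.succ_ne_zero, if_false, Nat.add_sub_add_right, Nat.sub_zero] at h1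
  exact eq_neg_of_add_eq_zero_left h1

theorem sum_shift_mul_of_mul_eq_C {f g : PowerSeries R} {P : R} (h : g * f = C P) (n : ℕ) :
    ∑ i ∈ range (n + 1), coeff (n - i) g * coeff (i + 1) f = -(coeff (n + 1) g * coeff 0 f) := by
  have h1 := congrArg (coeff (n + 1)) h
  rw [coeff_mul, ← Finset.Nat.sum_antidiagonal_swap] at h1
  simp only [Prod.fst_swap, Prod.snd_swap] at h1
  rw [Nat.sum_antidiagonal_eq_sum_range_succ (fun i j => coeff j g * coeff i f),
    Finset.sum_range_succ'] at h1
  simp only [coeff_C, Nat.succ_ne_zero, if_false, Nat.add_sub_add_right, Nat.sub_zero] at h1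
  exact eq_neg_of_add_eq_zero_left h1

end PowerSeries

section Convolution

open Finset

variable {R : Type*} [Ring R] {f g : ℕ → R}

/-- If `g` is a convolution inverse of `f` on both sides, up to the constant terms, then the Hankel
matrix of the shifted sequence `f (n + 1)` is carried to that of `-g (n + 1)` by the triangular
Toeplitz matrices of `g`. -/
theorem sum_sum_conv_hankel
    (hr : ∀ n, ∑ i ∈ range (n + 1), f (i + 1) * g (n - i) = -(f 0 * g (n + 1)))
    (hl : ∀ n, ∑ i ∈ range (n + 1), g (n - i) * f (i + 1) = -(g (n + 1) * f 0)) (a b : ℕ) :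
    ∑ i ∈ range (a + 1), ∑ j ∈ range (b + 1), g (a - i) * f (i + j + 1) * g (b - j) =
      -(g 0 * f 0 * g (a + b + 1)) := by
  induction a generalizing b with
  | zero =>
    simp only [zero_add, range_one, sum_singleton, Nat.sub_zero, mul_assoc]
    rw [← mul_sum, hr, mul_neg]
  | succ a ih =>
    have h := ih (b + 1)
    simp_rw [sum_range_succ' _ (b + 1)] at h
    rw [sum_add_distrib] at h
    simp only [Nat.sub_zero, add_zero, Nat.add_sub_add_right] at h
    rw [← sum_mul, hl] at h
    rw [sum_range_succ']
    simp only [Nat.sub_zero, zero_add, Nat.add_sub_add_right, mul_assoc] at h ⊢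
    rw [← mul_sum, hr, show a + 1 + b + 1 = a + (b + 1) + 1 by ring, ← h, neg_mul, mul_neg,
      mul_assoc]
    simp only [add_assoc, add_comm 1]

/-- The analogue of `sum_sum_conv_hankel` for the Schur complement of `f 0` in the Hankel
matrix of `f`. -/
theorem sum_sum_conv_hankel_schur
    (hr : ∀ n, ∑ i ∈ range (n + 1), f (i + 1) * g (n - i) = -(f 0 * g (n + 1)))
    (hl : ∀ n, ∑ i ∈ range (n + 1), g (n - i) * f (i + 1) = -(g (n + 1) * f 0))
    (h0 : f 0 * g 0 * f 0 = f 0) (a b : ℕ) :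
    ∑ i ∈ range (a + 1), ∑ j ∈ range (b + 1),
        g (a - i) * (f (i + j + 2) - f (i + 1) * g 0 * f (j + 1)) * g (b - j) =
      -(g 0 * f 0 * g (a + b + 2)) := by
  have h1 := sum_sum_conv_hankel hr hl (a + 1) b
  rw [sum_range_succ'] at h1
  simp only [Nat.sub_zero, zero_add, Nat.add_sub_add_right, mul_assoc] at h1
  rw [← mul_sum, hr] at h1
  have h2 : ∑ i ∈ range (a + 1), ∑ j ∈ range (b + 1),
      g (a - i) * (f (i + 1) * g 0 * f (j + 1)) * g (b - j) = g (a + 1) * f 0 * g (b + 1) := by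
    calc _ = (∑ i ∈ range (a + 1), g (a - i) * f (i + 1)) * g 0 *
          ∑ j ∈ range (b + 1), f (j + 1) * g (b - j) := by
            rw [sum_mul, sum_mul_sum]; simp only [mul_assoc]
      _ = g (a + 1) * (f 0 * g 0 * f 0) * g (b + 1) := by
            rw [hr, hl]; simp only [neg_mul, mul_neg, neg_neg, mul_assoc]
      _ = _ := by rw [h0]
  simp only [mul_sub, sub_mul, sum_sub_distrib, h2]
  have h3 : ∑ i ∈ range (a + 1), ∑ j ∈ range (b + 1), g (a - i) * f (i + j + 2) * g (b - j) =
      -(g 0 * (f 0 * g (a + b + 2))) + g (a + 1) * (f 0 * g (b + 1)) := by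
    rw [show a + b + 2 = a + 1 + b + 1 by ring, ← h1, mul_neg, neg_add_cancel_right]
    simp only [mul_assoc, add_assoc, add_comm, add_left_comm]
  rw [h3]
  simp only [mul_assoc, add_sub_cancel_right]

end Convolution

section Toeplitz

variable {R : Type*} [Ring R]

/-- The lower triangular Toeplitz matrix with first column `D`. -/
def lowerToeplitz (D : ℕ → R) (n : ℕ) : Matrix (Fin n) (Fin n) R :=
  Matrix.of fun a i => if i ≤ a then D (a - i) else 0

theorem sum_ite_le_eq_sum_range {n : ℕ} (a : Fin n) (f : ℕ → R) :
    ∑ i : Fin n, (if i ≤ a then f i else 0) = ∑ i ∈ Finset.range (a + 1), f i := by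
  simp only [Fin.le_def]
  rw [Fin.sum_univ_eq_sum_range (fun i => if i ≤ (a : ℕ) then f i else 0), ← Finset.sum_filter]
  congr 1
  ext i
  simp only [Finset.mem_filter, Finset.mem_range]
  omega

variable [StarRing R]

theorem lowerToeplitz_mul_mul_conjTranspose_apply (D : ℕ → R) {n : ℕ} (w : ℕ → ℕ → R)
    (a b : Fin n) :
    (lowerToeplitz D n * Matrix.of (fun i j : Fin n => w i j) * (lowerToeplitz D n)ᴴ) a b =
      ∑ i ∈ Finset.range (a + 1), ∑ j ∈ Finset.range (b + 1),
        D (a - i) * w i j * star (D (b - j)) := by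
  rw [Matrix.mul_assoc]
  simp only [Matrix.mul_apply, lowerToeplitz, Matrix.of_apply, conjTranspose_apply, ite_mul,
    zero_mul, apply_ite star, star_zero, mul_ite, mul_zero]
  rw [sum_ite_le_eq_sum_range a (fun i => D (a - i) * ∑ x : Fin n,
    if x ≤ b then w i x * star (D (b - x)) else 0)]
  refine Finset.sum_congr rfl fun i _ => ?_
  rw [sum_ite_le_eq_sum_range b (fun j => w i j * star (D (b - j))), Finset.mul_sum]
  simp only [mul_assoc]

/-- A column with unit last entry that `T * W * Tᴴ` maps to a multiple of the last unit vector
yields one that `W` maps to the same vector, when `T` is lower triangular Toeplitz and its diagonal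
entry acts as the identity on the entries of `W`. -/
theorem exists_mulVec_eq_single_of_lowerToeplitz {D : ℕ → R} {k : ℕ}
    {W : Matrix (Fin (k + 1)) (Fin (k + 1)) R} (hD : star (D 0) = D 0)
    (hl : ∀ i j, D 0 * W i j = W i j) (hr : ∀ i j, W i j * D 0 = W i j)
    {X : Fin (k + 1) → R} (hX : X (Fin.last k) = 1) {L : R}
    (h : (lowerToeplitz D (k + 1) * W * (lowerToeplitz D (k + 1))ᴴ) *ᵥ X =
      Pi.single (Fin.last k) L) :
    ∃ Y : Fin (k + 1) → R, Y (Fin.last k) = 1 ∧ W *ᵥ Y = Pi.single (Fin.last k) L := by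
  set T := lowerToeplitz D (k + 1) with hT
  refine ⟨Tᴴ *ᵥ X + Pi.single (Fin.last k) (1 - D 0), ?_, ?_⟩
  · have : (Tᴴ *ᵥ X) (Fin.last k) = D 0 := by
      rw [mulVec, dotProduct, Finset.sum_eq_single (Fin.last k)]
      · simp [hT, lowerToeplitz, hD, hX]
      · intro b _ hb
        have : ¬ Fin.last k ≤ b := fun h' => hb (le_antisymm (Fin.le_last b) h')
        simp [hT, lowerToeplitz, this]
      · simp
    simp [this]
  · have h0 : W *ᵥ Pi.single (Fin.last k) (1 - D 0) = 0 := by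
      ext i
      simp [mulVec_single, mul_sub, hr]
    rw [mulVec_add, h0, add_zero]
    rw [← mulVec_mulVec, ← mulVec_mulVec] at h
    set g := W *ᵥ (Tᴴ *ᵥ X) with hg
    have hPg : ∀ i, D 0 * g i = g i := fun i => by
      simp only [hg, mulVec, dotProduct, Finset.mul_sum, ← mul_assoc, hl]
    funext a
    induction a using WellFoundedLT.induction with
    | ind a ih =>
      rw [← h, mulVec, dotProduct, Finset.sum_eq_single a]
      · simp [hT, lowerToeplitz, hPg]
      · intro i _ hi
        rcases lt_or_gt_of_ne hi with hlt | hgt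
        · rw [ih i hlt, Pi.single_eq_of_ne (hlt.trans_le (Fin.le_last a)).ne, mul_zero]
        · simp [hT, lowerToeplitz, not_le.2 hgt]
      · simp

end Toeplitz

section Block

variable {q : ℕ}

/-- Positive semidefiniteness of a matrix whose entries are square matrices. -/
def BlockPosSemidef {ι : Type*} (M : Matrix ι ι (Matrix (Fin q) (Fin q) ℂ)) : Prop :=
  (Matrix.comp ι ι (Fin q) (Fin q) ℂ M).PosSemidef

theorem comp_mul {ι κ μ : Type*} [Fintype κ] (A : Matrix ι κ (Matrix (Fin q) (Fin q) ℂ))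
    (B : Matrix κ μ (Matrix (Fin q) (Fin q) ℂ)) :
    Matrix.comp ι μ _ _ ℂ (A * B) = Matrix.comp ι κ _ _ ℂ A * Matrix.comp κ μ _ _ ℂ B := by
  ext ⟨a, x⟩ ⟨b, y⟩
  simp only [Matrix.comp_apply, Matrix.mul_apply, Matrix.sum_apply, Fintype.sum_prod_type]

theorem BlockPosSemidef.conjTranspose_mul_mul_same {ι κ : Type*} [Fintype ι] [Fintype κ]
    {M : Matrix ι ι (Matrix (Fin q) (Fin q) ℂ)} (hM : BlockPosSemidef M)
    (F : Matrix ι κ (Matrix (Fin q) (Fin q) ℂ)) : BlockPosSemidef (Fᴴ * M * F) := by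
  rw [BlockPosSemidef, comp_mul, comp_mul]
  exact Matrix.PosSemidef.conjTranspose_mul_mul_same hM (Matrix.comp ι κ _ _ ℂ F)

/-- The Hankel matrix of `s` with matrix entries. -/
def blockHankel (s : ℕ → Matrix (Fin q) (Fin q) ℂ) (n : ℕ) :
    Matrix (Fin n) (Fin n) (Matrix (Fin q) (Fin q) ℂ) :=
  Matrix.of fun a b => s (a + b)

theorem blockPosSemidef_blockHankel_iff {s : ℕ → Matrix (Fin q) (Fin q) ℂ} {n : ℕ} :
    BlockPosSemidef (blockHankel s (n + 1)) ↔ (hankelMat s n).PosSemidef := Iff.rfl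

theorem Matrix.PosSemidef.mul_mp_mul_of_fromBlocks {m n : Type*} [Fintype m] [Fintype n]
    {A : Matrix m m ℂ} {B : Matrix m n ℂ} {C : Matrix n m ℂ} {D : Matrix n n ℂ}
    (h : (fromBlocks A B C D).PosSemidef) :
    A.IsHermitian ∧ Bᴴ = C ∧ A * mp A * B = B := by
  classical
  obtain ⟨hA, hC, -, -⟩ := Matrix.isHermitian_fromBlocks_iff.1 h.isHermitian
  refine ⟨hA, hC, ?_⟩
  have hmp := isMP_mp_of_isHermitian hA
  set N := 1 - A * mp A with hN
  have hNh : Nᴴ = N := by simp [hN, hmp.2.2.1]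
  have hAN : A * N = 0 := by
    rw [hN, mul_sub, mul_one, ← hmp.comm_of_isHermitian hA, ← mul_assoc, hmp.1, sub_self]
  have hz := h.mul_eq_zero_of_conjTranspose_mul_mul_eq_zero (fromRows N (0 : Matrix n m ℂ)) (by
    rw [Matrix.mul_assoc, fromBlocks_mul_fromRows, conjTranspose_fromRows_eq_fromCols_conjTranspose,
      fromCols_mul_fromRows]
    simp [hAN])
  rw [fromBlocks_mul_fromRows] at hz
  have hCN : C * N = 0 := by
    ext i j
    simpa using congrFun (congrFun hz (Sum.inr i)) j
  have hNB : N * B = 0 := by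
    have : (C * N)ᴴ = 0 := by rw [hCN, conjTranspose_zero]
    rwa [conjTranspose_mul, hNh, ← hC, conjTranspose_conjTranspose] at this
  rwa [hN, Matrix.sub_mul, Matrix.one_mul, sub_eq_zero, eq_comm] at hNB

section Lschur

variable {s : ℕ → Matrix (Fin q) (Fin q) ℂ} {k : ℕ}

theorem posSemidef_fromBlocks_of_hankelMat (h : (hankelMat s k).PosSemidef) :
    (fromBlocks
      (Matrix.of fun (jm : Fin k × Fin q) (lm : Fin k × Fin q) =>
        s (jm.1.val + lm.1.val) jm.2 lm.2)
      (Matrix.of fun (jm : Fin k × Fin q) (b : Fin q) => s (k + jm.1.val) jm.2 b)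
      (Matrix.of fun (a : Fin q) (lm : Fin k × Fin q) => s (k + lm.1.val) a lm.2)
      (s (2 * k))).PosSemidef := by
  have h' := h.submatrix (Sum.elim (fun jm : Fin k × Fin q => (Fin.castSucc jm.1, jm.2))
    (fun a => (Fin.last k, a)))
  convert h' using 1
  ext (i | i) (j | j) <;> simp [hankelMat, add_comm k, two_mul]

theorem exists_blockHankel_mulVec_eq (h : (hankelMat s k).PosSemidef) :
    ∃ X : Fin (k + 1) → Matrix (Fin q) (Fin q) ℂ, X (Fin.last k) = 1 ∧
      blockHankel s (k + 1) *ᵥ X = Pi.single (Fin.last k) (Lschur s k) := by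
  obtain ⟨-, -, hH⟩ := (posSemidef_fromBlocks_of_hankelMat h).mul_mp_mul_of_fromBlocks
  set H := Matrix.of fun (jm : Fin k × Fin q) (lm : Fin k × Fin q) =>
    s (jm.1.val + lm.1.val) jm.2 lm.2 with hHdef
  set y := Matrix.of fun (jm : Fin k × Fin q) (b : Fin q) => s (k + jm.1.val) jm.2 b with hy
  set G := mp H * y with hG
  refine ⟨Fin.snoc (fun a => Matrix.of fun x b => -G (a, x) b) 1, by simp, ?_⟩
  funext a
  ext x b
  induction a using Fin.lastCases with
  | last =>
    simp [mulVec, dotProduct, Fin.sum_univ_castSucc, blockHankel, Lschur, ← hHdef, ← hy,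
      Matrix.sum_apply, Matrix.mul_assoc, ← hG]
    simp [Matrix.mul_apply, Fintype.sum_prod_type, two_mul]
    ring
  | cast a =>
    have h1 := congrFun (congrFun hH (a, x)) b
    rw [Matrix.mul_assoc, ← hG] at h1
    simp [mulVec, dotProduct, Fin.sum_univ_castSucc, blockHankel, Matrix.sum_apply]
    simp [Matrix.mul_apply, Fintype.sum_prod_type, H, y] at h1 ⊢
    rw [h1, add_comm k, neg_add_cancel]

theorem Lschur_eq_of_blockHankel_mulVec_eq (h : (hankelMat s k).PosSemidef)
    {X : Fin (k + 1) → Matrix (Fin q) (Fin q) ℂ} (hX : X (Fin.last k) = 1)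
    {L : Matrix (Fin q) (Fin q) ℂ}
    (hL : blockHankel s (k + 1) *ᵥ X = Pi.single (Fin.last k) L) : Lschur s k = L := by
  obtain ⟨hHh, hyz, hH⟩ := (posSemidef_fromBlocks_of_hankelMat h).mul_mp_mul_of_fromBlocks
  rw [Lschur]
  set H := Matrix.of fun (jm : Fin k × Fin q) (lm : Fin k × Fin q) =>
    s (jm.1.val + lm.1.val) jm.2 lm.2 with hHdef
  set y := Matrix.of fun (jm : Fin k × Fin q) (b : Fin q) => s (k + jm.1.val) jm.2 b with hy
  set z := Matrix.of fun (a : Fin q) (lm : Fin k × Fin q) => s (k + lm.1.val) a lm.2 with hz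
  set V : Matrix (Fin k × Fin q) (Fin q) ℂ :=
    Matrix.of fun jm b => X (Fin.castSucc jm.1) jm.2 b with hV
  have h1 : y = -(H * V) := by
    ext ⟨a, x⟩ b
    have := congrFun (congrFun (congrFun hL (Fin.castSucc a)) x) b
    simp [mulVec, dotProduct, Fin.sum_univ_castSucc, blockHankel, Matrix.sum_apply, hX] at this
    simp [Matrix.mul_apply, Fintype.sum_prod_type, H, y, V] at this ⊢
    rw [← eq_neg_iff_add_eq_zero] at this
    rw [this, add_comm k, neg_neg]
  have h2 : s (2 * k) + z * V = L := by
    ext x b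
    have := congrFun (congrFun (congrFun hL (Fin.last k)) x) b
    simp [mulVec, dotProduct, Fin.sum_univ_castSucc, blockHankel, Matrix.sum_apply, hX] at this
    simp [Matrix.mul_apply, Fintype.sum_prod_type, z, V, two_mul] at this ⊢
    rw [← this, add_comm]
  have h3 : z = -(Vᴴ * H) := by
    rw [← hyz, h1, conjTranspose_neg, conjTranspose_mul, hHh.eq]
  rw [← h2, Matrix.mul_assoc, h3, Matrix.neg_mul, Matrix.mul_assoc, ← Matrix.mul_assoc H, hH, h1]
  simp [Matrix.mul_assoc, sub_eq_add_neg]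

end Lschur

end Block

section Recip

variable {q : ℕ}

theorem mul_mp_mul_recip {s : ℕ → Matrix (Fin q) (Fin q) ℂ} (h0 : (s 0).IsHermitian) (j : ℕ) :
    s 0 * mp (s 0) * recip s j = recip s j := by
  have hmp := isMP_mp_of_isHermitian h0
  have h : s 0 * mp (s 0) * mp (s 0) = mp (s 0) := by
    rw [← hmp.comm_of_isHermitian h0, hmp.2.1]
  cases j with
  | zero => rw [recip, h]
  | succ j => rw [recip, mul_neg, ← mul_assoc, h]

theorem recip_congr {s s' : ℕ → Matrix (Fin q) (Fin q) ℂ} (h0 : (s 0).IsHermitian) {n : ℕ}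
    (h : ∀ j ≤ n, s' j = s 0 * mp (s 0) * s j * (s 0 * mp (s 0))) :
    ∀ j ≤ n, recip s' j = recip s j := by
  have hmp := isMP_mp_of_isHermitian h0
  have hs0 : s' 0 = s 0 := by
    rw [h 0 (Nat.zero_le n), hmp.1, ← hmp.comm_of_isHermitian h0, ← mul_assoc, hmp.1]
  intro j
  induction j using Nat.strong_induction_on with
  | _ j ih =>
    intro hj
    cases j with
    | zero => rw [recip, recip, hs0]
    | succ j =>
      rw [recip, recip, hs0, Finset.mul_sum, Finset.mul_sum]
      congr 1
      refine Finset.sum_congr rfl fun l _ => ?_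
      have hl := l.isLt
      rw [ih l hl (by omega), h _ (by omega), mul_assoc _ (s 0 * mp (s 0)),
        mul_mp_mul_recip h0, ← mul_assoc, ← mul_assoc, ← mul_assoc, hmp.2.1, mul_assoc]

/-- All entries are Hermitian with column space inside that of the first one. -/
structure IsDominated (s : ℕ → Matrix (Fin q) (Fin q) ℂ) : Prop where
  isHermitian : ∀ j, (s j).IsHermitian
  mul_mp_mul : ∀ j, s 0 * mp (s 0) * s j = s j

namespace IsDominated

variable {s : ℕ → Matrix (Fin q) (Fin q) ℂ}

theorem isMP (h : IsDominated s) : IsMP (s 0) (mp (s 0)) :=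
  isMP_mp_of_isHermitian (h.isHermitian 0)

theorem mp_mul_comm (h : IsDominated s) : mp (s 0) * s 0 = s 0 * mp (s 0) :=
  h.isMP.comm_of_isHermitian (h.isHermitian 0)

theorem mul_mul_mp (h : IsDominated s) (j : ℕ) : s j * (s 0 * mp (s 0)) = s j := by
  have := congrArg conjTranspose (h.mul_mp_mul j)
  rwa [conjTranspose_mul, h.isMP.2.2.1, (h.isHermitian j).eq] at this

theorem isDominated_shiftA (h : IsDominated s) (α : ℝ) : IsDominated (shiftA (α : ℂ) s) where
  isHermitian j := by
    cases j with
    | zero => exact h.isHermitian 0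
    | succ j =>
      simp [shiftA, Matrix.IsHermitian, (h.isHermitian _).eq]
  mul_mp_mul j := by
    cases j with
    | zero => exact h.mul_mp_mul 0
    | succ j => simp only [shiftA, mul_add, mul_smul_comm, h.mul_mp_mul]

open PowerSeries in
theorem mk_mul_mk_recip (h : IsDominated s) :
    PowerSeries.mk s * PowerSeries.mk (recip s) = C (s 0 * mp (s 0)) := by
  ext1 n
  rw [coeff_mul, coeff_C]
  simp only [coeff_mk]
  cases n with
  | zero => simp [recip]
  | succ n =>
    rw [← Finset.Nat.sum_antidiagonal_swap]
    simp only [Prod.fst_swap, Prod.snd_swap]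
    rw [Finset.Nat.sum_antidiagonal_eq_sum_range_succ (fun i j => s j * recip s i),
      Finset.sum_range_succ, Nat.sub_self, recip, mul_neg, ← mul_assoc,
      Fin.sum_univ_eq_sum_range (fun l => s (n + 1 - l) * recip s l), Finset.mul_sum]
    simp [← mul_assoc, h.mul_mp_mul]

open PowerSeries in
theorem conjTranspose_recip_and_mul (h : IsDominated s) :
    (∀ j, (recip s j)ᴴ = recip s j) ∧
      PowerSeries.mk (recip s) * PowerSeries.mk s = C (s 0 * mp (s 0)) := by
  set B := PowerSeries.mk (recip s)
  set B' := PowerSeries.mk fun j => (recip s j)ᴴ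
  have hB'A : B' * PowerSeries.mk s = C (s 0 * mp (s 0)) := by
    ext1 n
    have hn := congrArg (fun f => (coeff n f)ᴴ) h.mk_mul_mk_recip
    simp only [coeff_mul, coeff_C, coeff_mk, conjTranspose_sum, conjTranspose_mul,
      (h.isHermitian _).eq] at hn ⊢
    rw [← Finset.Nat.sum_antidiagonal_swap]
    simp only [Prod.fst_swap, Prod.snd_swap, B', coeff_mk, hn]
    split_ifs
    · simpa using h.isMP.2.2.1
    · simp
  have hB' : B' * C (s 0 * mp (s 0)) = B' := by
    ext1 n
    have := congrArg conjTranspose (mul_mp_mul_recip (h.isHermitian 0) n)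
    rw [conjTranspose_mul, h.isMP.2.2.1] at this
    rwa [coeff_mul_C, coeff_mk]
  have hB : C (s 0 * mp (s 0)) * B = B := by
    ext1 n
    rw [coeff_C_mul, coeff_mk, mul_mp_mul_recip (h.isHermitian 0)]
  have hBB : B' = B := by
    rw [← hB', ← h.mk_mul_mk_recip, ← mul_assoc, hB'A, hB]
  refine ⟨fun j => ?_, hBB ▸ hB'A⟩
  simpa [B, B'] using congrArg (coeff j) hBB

theorem conjTranspose_recip (h : IsDominated s) (j : ℕ) : (recip s j)ᴴ = recip s j :=
  h.conjTranspose_recip_and_mul.1 j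

end IsDominated

open PowerSeries in
theorem mk_shiftA (α : ℂ) (s : ℕ → Matrix (Fin q) (Fin q) ℂ) :
    PowerSeries.mk (shiftA α s) = PowerSeries.mk s - α • (X * PowerSeries.mk s) := by
  ext1 n
  cases n with
  | zero => simp [shiftA]
  | succ n => simp [shiftA, coeff_succ_X_mul, sub_eq_neg_add]

end Recip

section SchurTransform

variable {q : ℕ} {s : ℕ → Matrix (Fin q) (Fin q) ℂ}

namespace IsDominated

theorem recipA_zero (α : ℂ) : recipA α s 0 = mp (s 0) := by
  rw [recipA, recip, shiftA]

theorem conjTranspose_shiftA_recipA (h : IsDominated s) (α : ℝ) (j : ℕ) :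
    (shiftA (α : ℂ) (recipA (α : ℂ) s) j)ᴴ = shiftA (α : ℂ) (recipA (α : ℂ) s) j := by
  cases j <;> simp [shiftA, recipA, (h.isDominated_shiftA α).conjTranspose_recip]

open PowerSeries in
theorem mk_mul_mk_shiftA_recipA (h : IsDominated s) (α : ℝ) :
    PowerSeries.mk s * PowerSeries.mk (shiftA (α : ℂ) (recipA (α : ℂ) s)) =
      C (s 0 * mp (s 0)) := by
  refine Eq.trans ?_ (h.isDominated_shiftA α).mk_mul_mk_recip
  rw [mk_shiftA, mk_shiftA, mul_sub, sub_mul, mul_smul_comm, smul_mul_assoc, ← mul_assoc,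
    ← X_mul, recipA]

open PowerSeries in
theorem mk_shiftA_recipA_mul_mk (h : IsDominated s) (α : ℝ) :
    PowerSeries.mk (shiftA (α : ℂ) (recipA (α : ℂ) s)) * PowerSeries.mk s =
      C (s 0 * mp (s 0)) := by
  refine Eq.trans ?_ (h.isDominated_shiftA α).conjTranspose_recip_and_mul.2
  rw [mk_shiftA, mk_shiftA, mul_sub, sub_mul, mul_smul_comm, smul_mul_assoc, ← mul_assoc,
    X_mul, recipA]

/-- The Hankel matrix of the Schur transform is congruent to that of the shifted sequence. -/
theorem blockHankel_schur1 (h : IsDominated s) (α : ℝ) (n : ℕ) :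
    blockHankel (schur1 (α : ℂ) s) n =
      lowerToeplitz (fun j => s 0 * recipA (α : ℂ) s j) n *
        blockHankel (fun i => (-(α : ℂ)) • s i + s (i + 1)) n *
        (lowerToeplitz (fun j => s 0 * recipA (α : ℂ) s j) n)ᴴ := by
  have hA := h.isDominated_shiftA α
  have hr := sum_mul_shift_of_mul_eq_C hA.mk_mul_mk_recip
  have hl := sum_shift_mul_of_mul_eq_C hA.conjTranspose_recip_and_mul.2
  simp only [PowerSeries.coeff_mk] at hr hl
  refine Matrix.ext fun a b => ?_
  refine Eq.trans ?_ (lowerToeplitz_mul_mul_conjTranspose_apply _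
    (fun i j => (-(α : ℂ)) • s (i + j) + s (i + j + 1)) a b).symm
  have key := sum_sum_conv_hankel hr hl a b
  have h0 : recip (shiftA (α : ℂ) s) 0 * shiftA (α : ℂ) s 0 = s 0 * mp (s 0) := by
    rw [recip, hA.mp_mul_comm, shiftA]
  rw [h0, show s 0 * mp (s 0) = shiftA (α : ℂ) s 0 * mp (shiftA (α : ℂ) s 0) from rfl,
    mul_mp_mul_recip (hA.isHermitian 0)] at key
  simp only [star_eq_conjTranspose, conjTranspose_mul, recipA, hA.conjTranspose_recip,
    (h.isHermitian 0).eq]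
  simp only [blockHankel, of_apply, schur1, recipA, ← key, Finset.mul_sum, Finset.sum_mul,
    mul_assoc, shiftA]

/-- The Schur complement of the first entry in a block Hankel matrix. -/
noncomputable def hankelSchur (s : ℕ → Matrix (Fin q) (Fin q) ℂ) (n : ℕ) :
    Matrix (Fin n) (Fin n) (Matrix (Fin q) (Fin q) ℂ) :=
  Matrix.of fun i j => s (i + j + 2) - s (i + 1) * mp (s 0) * s (j + 1)

/-- The shifted Hankel matrix of the Schur transform is congruent to the Schur complement of the
first entry in the Hankel matrix. -/
theorem blockHankel_shift_schur1 (h : IsDominated s) (α : ℝ) (n : ℕ) :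
    blockHankel (fun i => (-(α : ℂ)) • schur1 (α : ℂ) s i + schur1 (α : ℂ) s (i + 1)) n =
      lowerToeplitz (fun j => s 0 * shiftA (α : ℂ) (recipA (α : ℂ) s) j) n *
        hankelSchur s n *
        (lowerToeplitz (fun j => s 0 * shiftA (α : ℂ) (recipA (α : ℂ) s) j) n)ᴴ := by
  have hA := h.isDominated_shiftA α
  set r := shiftA (α : ℂ) (recipA (α : ℂ) s) with hrdef
  have hr0 : r 0 = mp (s 0) := recipA_zero _
  have hr := sum_mul_shift_of_mul_eq_C (h.mk_mul_mk_shiftA_recipA α)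
  have hl := sum_shift_mul_of_mul_eq_C (h.mk_shiftA_recipA_mul_mk α)
  simp only [PowerSeries.coeff_mk, ← hrdef] at hr hl
  refine Matrix.ext fun a b => ?_
  refine Eq.trans ?_ (lowerToeplitz_mul_mul_conjTranspose_apply _
    (fun i j => s (i + j + 2) - s (i + 1) * mp (s 0) * s (j + 1)) a b).symm
  have key := sum_sum_conv_hankel_schur hr hl (by rw [hr0, h.isMP.1]) a b
  rw [hr0, h.mp_mul_comm] at key
  have hProj : s 0 * (s 0 * mp (s 0)) = s 0 := by
    rw [← h.mp_mul_comm, ← mul_assoc, h.isMP.1]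
  simp only [star_eq_conjTranspose, conjTranspose_mul, h.conjTranspose_shiftA_recipA, hrdef,
    (h.isHermitian 0).eq]
  rw [← hrdef]
  trans s 0 * -(s 0 * mp (s 0) * r (a + b + 2)) * s 0
  · rw [mul_neg, ← mul_assoc (s 0), hProj]
    simp [blockHankel, schur1, hrdef, shiftA, mul_add, add_mul, add_comm]
  · rw [← key]
    simp only [Finset.mul_sum, Finset.sum_mul, mul_assoc]

/-- Block column elimination of the first entry of a Hankel matrix. -/
noncomputable def eliminator (s : ℕ → Matrix (Fin q) (Fin q) ℂ) (n : ℕ) :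
    Matrix (Fin (n + 1)) (Fin n) (Matrix (Fin q) (Fin q) ℂ) :=
  Matrix.of fun i j => Fin.cases (-(mp (s 0) * s (j + 1))) (fun i => if i = j then 1 else 0) i

theorem blockHankel_mul_eliminator (h : IsDominated s) (n : ℕ) (j : Fin n) :
    (blockHankel s (n + 1) * eliminator s n) 0 j = 0 ∧
      ∀ i : Fin n, (blockHankel s (n + 1) * eliminator s n) i.succ j = hankelSchur s n i j := by
  constructor
  · simp [Matrix.mul_apply, Fin.sum_univ_succ, eliminator, blockHankel, ← mul_assoc, h.mul_mp_mul]
  · intro i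
    simp [Matrix.mul_apply, Fin.sum_univ_succ, eliminator, blockHankel, hankelSchur, ← mul_assoc]
    rw [show (i : ℕ) + 1 + (j + 1) = i + j + 2 by ring]
    abel

theorem eliminator_conjTranspose_mul_mul (h : IsDominated s) (n : ℕ) :
    (eliminator s n)ᴴ * blockHankel s (n + 1) * eliminator s n = hankelSchur s n := by
  refine Matrix.ext fun i j => ?_
  obtain ⟨h1, h2⟩ := h.blockHankel_mul_eliminator n j
  rw [Matrix.mul_assoc, Matrix.mul_apply, Fin.sum_univ_succ, h1]
  simp only [h2]
  simp [eliminator, apply_ite]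

theorem exists_blockHankel_mulVec_eq_of_hankelSchur (h : IsDominated s) {k : ℕ}
    {Y : Fin (k + 1) → Matrix (Fin q) (Fin q) ℂ} (hY : Y (Fin.last k) = 1)
    {L : Matrix (Fin q) (Fin q) ℂ}
    (hL : hankelSchur s (k + 1) *ᵥ Y = Pi.single (Fin.last k) L) :
    ∃ Z : Fin (k + 2) → Matrix (Fin q) (Fin q) ℂ, Z (Fin.last (k + 1)) = 1 ∧
      blockHankel s (k + 2) *ᵥ Z = Pi.single (Fin.last (k + 1)) L := by
  refine ⟨eliminator s (k + 1) *ᵥ Y, ?_, ?_⟩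
  · rw [← Fin.succ_last]
    simp only [mulVec, dotProduct, eliminator, of_apply, Fin.cases_succ, ite_mul, one_mul, zero_mul,
      Finset.sum_ite_eq, Finset.mem_univ, if_true, hY]
  · rw [mulVec_mulVec]
    funext i
    induction i using Fin.cases with
    | zero =>
      rw [Pi.single_eq_of_ne (Fin.last_pos.ne)]
      simp [mulVec, dotProduct, (h.blockHankel_mul_eliminator _ _).1]
    | succ i =>
      simp only [mulVec, dotProduct, (h.blockHankel_mul_eliminator _ _).2]
      refine (congrFun hL i).trans ?_
      rw [← Fin.succ_last]
      simp [Pi.single_apply]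

end IsDominated

theorem Kgg_iff {α : ℝ} {m : ℕ} : Kgg α (m : ℕ∞) s ↔
    (∀ n, 2 * n ≤ m → (hankelMat s n).PosSemidef) ∧
    (∀ n, 2 * n + 1 ≤ m →
      (hankelMat (fun i => (-(α : ℂ)) • s i + s (i + 1)) n).PosSemidef) := by
  simp only [Kgg, Nat.cast_le]
  rfl

theorem stieltjesParam_two_mul (α : ℂ) (k : ℕ) : stieltjesParam α s (2 * k) = Lschur s k := by
  simp [stieltjesParam]

theorem stieltjesParam_two_mul_add_one (α : ℂ) (k : ℕ) : stieltjesParam α s (2 * k + 1) =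
    Lschur (fun i => (-α) • s i + s (i + 1)) k := by
  rw [stieltjesParam, if_neg (by simp)]
  congr 1
  omega

theorem IsDominated.Kgg_schur1 (h : IsDominated s) {α : ℝ} {m : ℕ}
    (hs : Kgg α ((m + 1 : ℕ) : ℕ∞) s) : Kgg α (m : ℕ∞) (schur1 (α : ℂ) s) := by
  rw [Kgg_iff] at hs ⊢
  constructor <;> intro n hn <;> rw [← blockPosSemidef_blockHankel_iff]
  · rw [h.blockHankel_schur1]
    simpa using (blockPosSemidef_blockHankel_iff.2
      (hs.2 n (by omega))).conjTranspose_mul_mul_same (lowerToeplitz _ (n + 1))ᴴ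
  · rw [h.blockHankel_shift_schur1, ← h.eliminator_conjTranspose_mul_mul]
    simpa using ((blockPosSemidef_blockHankel_iff.2
      (hs.1 (n + 1) (by omega))).conjTranspose_mul_mul_same
        (eliminator s (n + 1))).conjTranspose_mul_mul_same (lowerToeplitz _ (n + 1))ᴴ

theorem IsDominated.stieltjesParam_succ (h : IsDominated s) {α : ℝ} {m : ℕ}
    (hs : Kgg α ((m + 1 : ℕ) : ℕ∞) s) {j : ℕ} (hj : j ≤ m) :
    stieltjesParam (α : ℂ) s (j + 1) = stieltjesParam (α : ℂ) (schur1 (α : ℂ) s) j := by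
  have ht := Kgg_iff.1 (h.Kgg_schur1 hs)
  rw [Kgg_iff] at hs
  have hstar : star (s 0 * mp (s 0)) = s 0 * mp (s 0) := h.isMP.2.2.1
  obtain ⟨k, rfl | rfl⟩ := j.even_or_odd'
  · rw [stieltjesParam_two_mul, stieltjesParam_two_mul_add_one]
    obtain ⟨X, hX, hXL⟩ := exists_blockHankel_mulVec_eq (ht.1 k hj)
    rw [h.blockHankel_schur1] at hXL
    obtain ⟨Y, hY, hYL⟩ := exists_mulVec_eq_single_of_lowerToeplitz
      (by rw [IsDominated.recipA_zero, hstar])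
      (by simp [IsDominated.recipA_zero, blockHankel, mul_add, h.mul_mp_mul])
      (by simp [IsDominated.recipA_zero, blockHankel, add_mul, h.mul_mul_mp]) hX hXL
    exact Lschur_eq_of_blockHankel_mulVec_eq (hs.2 k (by omega)) hY hYL
  · rw [stieltjesParam_two_mul_add_one, show 2 * k + 1 + 1 = 2 * (k + 1) by ring,
      stieltjesParam_two_mul]
    obtain ⟨X, hX, hXL⟩ := exists_blockHankel_mulVec_eq (ht.2 k hj)
    rw [h.blockHankel_shift_schur1] at hXL
    obtain ⟨Y, hY, hYL⟩ := exists_mulVec_eq_single_of_lowerToeplitz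
      (by rw [shiftA, IsDominated.recipA_zero, hstar])
      (by simp [shiftA, IsDominated.recipA_zero, hankelSchur, mul_sub, ← mul_assoc, h.mul_mp_mul])
      (by simp [shiftA, IsDominated.recipA_zero, hankelSchur, sub_mul, mul_assoc, h.mul_mul_mp])
      hX hXL
    obtain ⟨Z, hZ, hZL⟩ := h.exists_blockHankel_mulVec_eq_of_hankelSchur hY hYL
    exact Lschur_eq_of_blockHankel_mulVec_eq (hs.1 (k + 1) (by omega)) hZ hZL

end SchurTransform

section Compression

variable {q : ℕ} {s s' : ℕ → Matrix (Fin q) (Fin q) ℂ}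

theorem isHermitian_of_hankelMat {n : ℕ} (h : (hankelMat s n).PosSemidef) {j : ℕ}
    (hj : j ≤ 2 * n) : (s j).IsHermitian := by
  refine Matrix.ext fun x y => ?_
  have := congrFun (congrFun h.isHermitian (⟨min j n, by omega⟩, x)) (⟨j - min j n, by omega⟩, y)
  simp only [hankelMat, conjTranspose_apply, of_apply] at this
  rwa [show j - min j n + min j n = j by omega, show min j n + (j - min j n) = j by omega] at this

theorem mul_mp_mul_of_hankelMat {n i : ℕ} (h : (hankelMat s n).PosSemidef) (hi : i < n) :
    s (2 * i) * mp (s (2 * i)) * s (2 * i + 1) = s (2 * i + 1) := by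
  have h' := h.submatrix (Sum.elim (fun x : Fin q => ((⟨i, by omega⟩ : Fin (n + 1)), x))
    (fun x => (⟨i + 1, by omega⟩, x)))
  have heq : (hankelMat s n).submatrix
      (Sum.elim (fun x : Fin q => ((⟨i, by omega⟩ : Fin (n + 1)), x))
      (fun x => (⟨i + 1, by omega⟩, x)))
      (Sum.elim (fun x : Fin q => ((⟨i, by omega⟩ : Fin (n + 1)), x))
      (fun x => (⟨i + 1, by omega⟩, x))) =
      fromBlocks (s (2 * i)) (s (2 * i + 1)) (s (2 * i + 1)) (s (2 * i + 2)) := by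
    ext (x | x) (y | y) <;> simp [hankelMat] <;> ring_nf
  rw [heq] at h'
  exact h'.mul_mp_mul_of_fromBlocks.2.2

theorem Kgg.isHermitian {α : ℝ} {m : ℕ} (hs : Kgg α (m : ℕ∞) s) {j : ℕ} (hj : j ≤ m) :
    (s j).IsHermitian := by
  rw [Kgg_iff] at hs
  rcases lt_or_ge (2 * (m / 2)) j with h | h
  · obtain ⟨k, rfl⟩ : ∃ k, j = 2 * k + 1 := ⟨m / 2, by omega⟩
    have h1 := isHermitian_of_hankelMat (hs.2 k hj) le_rfl
    have h2 := isHermitian_of_hankelMat (hs.1 k (by omega)) le_rfl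
    rw [Matrix.IsHermitian] at h1 h2 ⊢
    simpa [h2] using h1
  · exact isHermitian_of_hankelMat (hs.1 (m / 2) (by omega)) h

theorem Kgg.mul_mp_mul {α : ℝ} {m : ℕ} (hs : Kgg α (m : ℕ∞) s) {j : ℕ} (hj : j < m) :
    s 0 * mp (s 0) * s j = s j := by
  have hmp := isMP_mp_of_isHermitian (hs.isHermitian (Nat.zero_le m))
  rw [Kgg_iff] at hs
  induction j using Nat.strong_induction_on with
  | _ j ih =>
    obtain ⟨i, rfl | rfl⟩ := j.even_or_odd'
    · cases i with
      | zero => exact hmp.1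
      | succ i =>
        have h1 := ih (2 * i + 1) (by omega) (by omega)
        have h2 := mul_mp_mul_of_hankelMat (hs.2 (i + 1) (by omega)) (Nat.lt_succ_self i)
        have h3 := congrArg (s 0 * mp (s 0) * ·) h2
        simp only [← mul_assoc (s 0 * mp (s 0))] at h3
        rw [mul_add (s 0 * mp (s 0)) ((-(α : ℂ)) • s (2 * i)), mul_smul_comm,
          ih (2 * i) (by omega) (by omega), h1, h2, mul_add, mul_smul_comm, h1] at h3
        exact (add_left_cancel h3).symm
    · rw [← mul_mp_mul_of_hankelMat (hs.1 (i + 1) (by omega)) (Nat.lt_succ_self i), ← mul_assoc,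
        ← mul_assoc (s 0 * mp (s 0)), ih (2 * i) (by omega) (by omega)]

theorem hankelMat_posSemidef_of_eq {P : Matrix (Fin q) (Fin q) ℂ} (hP : Pᴴ = P) {n : ℕ}
    (h : ∀ j ≤ 2 * n, s' j = P * s j * P) (hs : (hankelMat s n).PosSemidef) :
    (hankelMat s' n).PosSemidef := by
  rw [← blockPosSemidef_blockHankel_iff] at hs ⊢
  convert hs.conjTranspose_mul_mul_same (Matrix.diagonal fun _ => P) using 1
  refine Matrix.ext fun a b => ?_
  rw [diagonal_conjTranspose, mul_diagonal, diagonal_mul, Pi.star_apply, star_eq_conjTranspose, hP]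
  exact h _ (by omega)

theorem Kgg.of_eq {α : ℝ} {m : ℕ} {P : Matrix (Fin q) (Fin q) ℂ} (hP : Pᴴ = P)
    (h : ∀ j ≤ m, s' j = P * s j * P) (hs : Kgg α (m : ℕ∞) s) : Kgg α (m : ℕ∞) s' := by
  rw [Kgg_iff] at hs ⊢
  refine ⟨fun n hn => hankelMat_posSemidef_of_eq hP (fun j hj => h j (by omega)) (hs.1 n hn),
    fun n hn => hankelMat_posSemidef_of_eq hP (fun j hj => ?_) (hs.2 n hn)⟩
  rw [h j (by omega), h (j + 1) (by omega)]
  simp only [mul_add, add_mul, mul_smul_comm, smul_mul_assoc]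

theorem Lschur_sub_congr {k : ℕ} (h : ∀ j < 2 * k, s' j = s j) :
    Lschur s' k - s' (2 * k) = Lschur s k - s (2 * k) := by
  have h1 : (Matrix.of fun (a : Fin q) (lm : Fin k × Fin q) => s' (k + lm.1.val) a lm.2) =
      Matrix.of fun (a : Fin q) (lm : Fin k × Fin q) => s (k + lm.1.val) a lm.2 := by
    ext a lm
    simp only [of_apply, h (k + lm.1.val) (by omega)]
  have h2 : (Matrix.of fun (jm lm : Fin k × Fin q) => s' (jm.1.val + lm.1.val) jm.2 lm.2) =
      Matrix.of fun (jm lm : Fin k × Fin q) => s (jm.1.val + lm.1.val) jm.2 lm.2 := by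
    ext jm lm
    simp only [of_apply, h (jm.1.val + lm.1.val) (by omega)]
  have h3 : (Matrix.of fun (jm : Fin k × Fin q) (b : Fin q) => s' (k + jm.1.val) jm.2 b) =
      Matrix.of fun (jm : Fin k × Fin q) (b : Fin q) => s (k + jm.1.val) jm.2 b := by
    ext jm b
    simp only [of_apply, h (k + jm.1.val) (by omega)]
  rw [Lschur, Lschur, h1, h2, h3]
  abel

theorem stieltjesParam_sub_congr (α : ℂ) {j : ℕ} (h : ∀ i < j, s' i = s i) :
    stieltjesParam α s' j - s' j = stieltjesParam α s j - s j := by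
  obtain ⟨k, rfl | rfl⟩ := j.even_or_odd'
  · rw [stieltjesParam_two_mul, stieltjesParam_two_mul, Lschur_sub_congr h]
  · rw [stieltjesParam_two_mul_add_one, stieltjesParam_two_mul_add_one]
    have := Lschur_sub_congr (s := fun i => (-α) • s i + s (i + 1))
      (s' := fun i => (-α) • s' i + s' (i + 1)) (k := k) fun i hi => by
        simp only [h i (by omega), h (i + 1) (by omega)]
    simp only [h (2 * k) (by omega), ← sub_sub, sub_right_comm _ ((-α) • s (2 * k))] at this
    exact sub_left_inj.1 this

theorem stieltjesParam_congr (α : ℂ) {j : ℕ} (h : ∀ i ≤ j, s' i = s i) :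
    stieltjesParam α s' j = stieltjesParam α s j := by
  have := stieltjesParam_sub_congr α fun i (hi : i < j) => h i hi.le
  rwa [h j le_rfl, sub_left_inj] at this

/-- The sequence cut off after the index `m` and compressed to the column space of its first
entry. -/
noncomputable def compression (s : ℕ → Matrix (Fin q) (Fin q) ℂ) (m j : ℕ) :
    Matrix (Fin q) (Fin q) ℂ :=
  if j ≤ m then s 0 * mp (s 0) * s j * (s 0 * mp (s 0)) else 0

theorem compression_of_le {m j : ℕ} (hj : j ≤ m) :
    compression s m j = s 0 * mp (s 0) * s j * (s 0 * mp (s 0)) :=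
  if_pos hj

theorem Kgg.compression_of_lt {α : ℝ} {m : ℕ} (hs : Kgg α (m : ℕ∞) s) {j : ℕ} (hj : j < m) :
    compression s m j = s j := by
  have h := congrArg conjTranspose (hs.mul_mp_mul hj)
  rw [conjTranspose_mul, (isMP_mp_of_isHermitian (hs.isHermitian (Nat.zero_le m))).2.2.1,
    (hs.isHermitian hj.le).eq] at h
  rw [compression_of_le hj.le, hs.mul_mp_mul hj, h]

theorem Kgg.isDominated_compression {α : ℝ} {m : ℕ} (hm : 0 < m) (hs : Kgg α (m : ℕ∞) s) :
    IsDominated (compression s m) := by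
  have hmp := isMP_mp_of_isHermitian (hs.isHermitian (Nat.zero_le m))
  refine ⟨fun j => ?_, fun j => ?_⟩
  · by_cases hj : j ≤ m
    · rw [compression_of_le hj, Matrix.IsHermitian, conjTranspose_mul (_ * s j),
        conjTranspose_mul _ (s j),
        hmp.2.2.1, (hs.isHermitian hj).eq]
      simp only [mul_assoc]
    · rw [compression, if_neg hj]
      exact isHermitian_zero
  · rw [hs.compression_of_lt hm]
    by_cases hj : j ≤ m
    · rw [compression_of_le hj]
      simp only [← mul_assoc, hmp.1]
    · rw [compression, if_neg hj, mul_zero]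

theorem Kgg.schur1_compression {α : ℝ} {m : ℕ} (hs : Kgg α (m : ℕ∞) s) {j : ℕ} (hj : j < m) :
    schur1 (α : ℂ) (compression s m) j = schur1 (α : ℂ) s j := by
  have h0 := hs.isHermitian (Nat.zero_le m)
  have hmp := isMP_mp_of_isHermitian h0
  have hrec : recipA (α : ℂ) (compression s m) (j + 1) = recipA (α : ℂ) s (j + 1) := by
    refine recip_congr (n := m) (by exact h0) (fun i hi => ?_) _ hj
    cases i with
    | zero => exact compression_of_le hi
    | succ i =>
      simp only [shiftA, compression_of_le hi, compression_of_le (Nat.le_of_succ_le hi), mul_add,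
        add_mul, mul_smul_comm, smul_mul_assoc]
  rw [schur1, schur1, hrec, hs.compression_of_lt (Nat.zero_lt_of_lt hj)]

end Compression

section Main

variable {q : ℕ} {s : ℕ → Matrix (Fin q) (Fin q) ℂ} {α : ℝ} {m : ℕ}

theorem Kgg.kgg_compression (hs : Kgg α (m : ℕ∞) s) : Kgg α (m : ℕ∞) (compression s m) :=
  hs.of_eq (isMP_mp_of_isHermitian (hs.isHermitian (Nat.zero_le m))).2.2.1
    fun _ => compression_of_le

theorem Kgg.kgg_schur1 (hs : Kgg α ((m + 1 : ℕ) : ℕ∞) s) :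
    Kgg α (m : ℕ∞) (schur1 (α : ℂ) s) := by
  refine ((hs.isDominated_compression m.succ_pos).Kgg_schur1 hs.kgg_compression).of_eq
    conjTranspose_one fun j hj => ?_
  rw [one_mul, mul_one, hs.schur1_compression (by omega)]

theorem Kgg.stieltjesParam_compression_succ (hs : Kgg α ((m + 1 : ℕ) : ℕ∞) s) {j : ℕ}
    (hj : j ≤ m) :
    stieltjesParam (α : ℂ) (compression s (m + 1)) (j + 1) =
      stieltjesParam (α : ℂ) (schur1 (α : ℂ) s) j := by
  rw [(hs.isDominated_compression m.succ_pos).stieltjesParam_succ hs.kgg_compression hj]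
  exact stieltjesParam_congr _ fun i hi => hs.schur1_compression (by omega)

theorem Kgg.stieltjesParam_succ_of_lt (hs : Kgg α ((m + 1 : ℕ) : ℕ∞) s) {j : ℕ} (hj : j < m) :
    stieltjesParam (α : ℂ) s (j + 1) = stieltjesParam (α : ℂ) (schur1 (α : ℂ) s) j := by
  rw [← hs.stieltjesParam_compression_succ hj.le]
  exact (stieltjesParam_congr _ fun i hi => hs.compression_of_lt (by omega)).symm

theorem Kgg.stieltjesParam_succ_self (hs : Kgg α ((m + 1 : ℕ) : ℕ∞) s) :
    stieltjesParam (α : ℂ) s (m + 1) =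
      stieltjesParam (α : ℂ) (schur1 (α : ℂ) s) m + Pjk (α : ℂ) s (m + 1) 0 := by
  have h0 := hs.isHermitian (Nat.zero_le _)
  have h := stieltjesParam_sub_congr (α : ℂ) fun i hi => hs.compression_of_lt (j := i) hi
  rw [hs.stieltjesParam_compression_succ le_rfl, compression_of_le le_rfl, sub_eq_sub_iff_add_eq_add,
    ← (isMP_mp_of_isHermitian h0).comm_of_isHermitian h0] at h
  nth_rw 1 [(isMP_mp_of_isHermitian h0).comm_of_isHermitian h0] at h
  rw [Pjk, Function.iterate_zero, id, ← add_sub_assoc, h, mul_assoc _ (mp (s 0)) (s 0),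
    add_sub_cancel_right]

theorem stieltjesParam_zero (α : ℂ) : stieltjesParam α s 0 = s 0 := by
  ext i j
  simp [stieltjesParam, Lschur, Matrix.mul_apply]

end Main

/-- Theorem 9.1: Q_m = s_0^{[m,α]} + Σ_{k=0}^{m-1} P_{m-k,k} and
    Q_j = s_0^{[j,α]} for 0 ≤ j ≤ m−1. -/
theorem stmt13 {q : ℕ} (α : ℝ) (m : ℕ)
    (s : ℕ → Matrix (Fin q) (Fin q) ℂ) (hs : Kgg α (m : ℕ∞) s) :
    stieltjesParam (α : ℂ) s m =
      (schur1 (α : ℂ))^[m] s 0 + ∑ k ∈ Finset.range m, Pjk (α : ℂ) s (m - k) k ∧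
    ∀ j : ℕ, j < m → stieltjesParam (α : ℂ) s j = (schur1 (α : ℂ))^[j] s 0 := by
  induction m generalizing s with
  | zero => simp [stieltjesParam_zero]
  | succ m ih =>
    obtain ⟨ih1, ih2⟩ := ih _ hs.kgg_schur1
    refine ⟨?_, fun j hj => ?_⟩
    · rw [hs.stieltjesParam_succ_self, ih1, Finset.sum_range_succ', ← add_assoc]
      congr 2
      refine Finset.sum_congr rfl fun k _ => ?_
      simp only [Pjk, Function.iterate_succ_apply, Nat.add_sub_add_right]
    · cases j with
      | zero => simp [stieltjesParam_zero]
      | succ j =>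
        rw [hs.stieltjesParam_succ_of_lt (Nat.lt_of_succ_lt_succ hj),
          ih2 j (Nat.lt_of_succ_lt_succ hj), Function.iterate_succ_apply]
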